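/- Dual (observer) half-gain theorem: let n ≥ 1 and α > 0, let A_ESO be the (n+1)×(n+1) real upper shift matrix, c = e₁ the first standard basis vector of ℝ^{n+1}, and l_BW ∈ ℝ^{n+1} the bandwidth-parameterization observer gain vector at β = α. Then there exists a symmetric matrix Q ∈ ℝ^{(n+1)×(n+1)} solving the dual algebraic Riccati equation (A_ESOᵀ + (α/2) I)ᵀ Q + Q (A_ESOᵀ + (α/2) I) − 2 Q c cᵀ Q = 0 with cᵀ Q = (1/2) l_BWᵀ, i.e. the α-design observer gains are exactly half the bandwidth-parameterization observer gains. -/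

import Mathlib

open Matrix

/-- The `m × m` upper shift matrix: `A i j = 1` if `j = i + 1`, else `0`. -/
noncomputable def shiftMat (m : ℕ) : Matrix (Fin m) (Fin m) ℝ :=
  Matrix.of fun i j => if (j : ℕ) = (i : ℕ) + 1 then 1 else 0

/-- The first standard basis vector `e₁` of `ℝᵐ`. -/
noncomputable def firstVec (m : ℕ) : Fin m → ℝ :=
  fun i => if (i : ℕ) = 0 then 1 else 0

/-- Bandwidth-parameterization observer gains at bandwidth `α`: the 1-based gain
`l_i = C(n+1, i) α^i`; with 0-based index `j : Fin (n+1)` this is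
`l j = C(n+1, j+1) α^(j+1)`. -/
noncomputable def lBW (n : ℕ) (α : ℝ) : Fin (n + 1) → ℝ :=
  fun j => ((n + 1).choose ((j : ℕ) + 1)) * α ^ ((j : ℕ) + 1)

/-- The sum `∑ k < m, C(k, i) C(k, j)`, the coefficient of `x ^ i * y ^ j` in
`(((1 + x) * (1 + y)) ^ m - 1) / ((1 + x) * (1 + y) - 1)`. -/
def sumChooseMulChoose (m i j : ℕ) : ℕ :=
  ∑ k ∈ Finset.range m, k.choose i * k.choose j

theorem sumChooseMulChoose_comm (m i j : ℕ) :
    sumChooseMulChoose m i j = sumChooseMulChoose m j i := by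
  simp only [sumChooseMulChoose, mul_comm]

theorem sumChooseMulChoose_self_left (m j : ℕ) : sumChooseMulChoose m m j = 0 :=
  Finset.sum_eq_zero fun k hk => by
    rw [Nat.choose_eq_zero_of_lt (Finset.mem_range.mp hk), zero_mul]

theorem sumChooseMulChoose_zero_left (m j : ℕ) :
    sumChooseMulChoose m 0 j = m.choose (j + 1) := by
  induction m with
  | zero => simp [sumChooseMulChoose]
  | succ m ih =>
    rw [sumChooseMulChoose, Finset.sum_range_succ, ← sumChooseMulChoose, ih, Nat.choose_succ_succ]
    simp [add_comm]

theorem sumChooseMulChoose_recurrence (m i j : ℕ) :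
    sumChooseMulChoose m (i + 1) j + sumChooseMulChoose m i (j + 1) + sumChooseMulChoose m i j
      = m.choose (i + 1) * m.choose (j + 1) := by
  induction m with
  | zero => simp [sumChooseMulChoose]
  | succ m ih =>
    simp only [sumChooseMulChoose, Finset.sum_range_succ] at ih ⊢
    rw [Nat.choose_succ_succ m i, Nat.choose_succ_succ m j]
    linear_combination ih

theorem shiftMat_mul_of (m : ℕ) (q : ℕ → ℕ → ℝ) (hq : ∀ j, q m j = 0) :
    shiftMat m * Matrix.of (fun i j : Fin m => q i j)
      = Matrix.of (fun i j : Fin m => q (i + 1) j) := by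
  ext i j
  simp only [Matrix.mul_apply, shiftMat, Matrix.of_apply, ite_mul, one_mul, zero_mul]
  by_cases hi : (i : ℕ) + 1 < m
  · rw [Finset.sum_eq_single (⟨i + 1, hi⟩ : Fin m)]
    · simp
    · intro b _ hb
      exact if_neg fun h => hb (Fin.ext h)
    · simp
  · have him : (i : ℕ) + 1 = m := by omega
    rw [him, hq]
    exact Finset.sum_eq_zero fun b _ => if_neg b.isLt.ne

theorem firstVec_vecMul (n : ℕ) (M : Matrix (Fin (n + 1)) (Fin (n + 1)) ℝ) :
    firstVec (n + 1) ᵥ* M = M 0 := by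
  have h : firstVec (n + 1) = Pi.single 0 1 := by
    ext i
    simp only [firstVec, Pi.single_apply, Fin.val_eq_zero_iff]
  rw [h, Matrix.single_one_vecMul]
  rfl

/-- Dual (observer) half-gain theorem: there exists a symmetric `Q` solving the dual
algebraic Riccati equation
`(A_ESOᵀ + (α/2) I)ᵀ Q + Q (A_ESOᵀ + (α/2) I) - 2 Q c cᵀ Q = 0`
with `cᵀ Q = (1/2) l_BWᵀ`. -/
theorem observer_half_gain_tuning (n : ℕ) (hn : 1 ≤ n) (α : ℝ) (hα : 0 < α) :
    ∃ Q : Matrix (Fin (n + 1)) (Fin (n + 1)) ℝ, Q.IsSymm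
      ∧ ((shiftMat (n + 1))ᵀ + (α / 2) • 1)ᵀ * Q + Q * ((shiftMat (n + 1))ᵀ + (α / 2) • 1)
          - (2 : ℝ) • (Q * vecMulVec (firstVec (n + 1)) (firstVec (n + 1)) * Q) = 0
      ∧ firstVec (n + 1) ᵥ* Q = (1 / 2 : ℝ) • lBW n α := by
  set q : ℕ → ℕ → ℝ := fun i j =>
    1 / 2 * α ^ (i + j + 1) * (sumChooseMulChoose (n + 1) i j : ℝ) with hq
  set Q : Matrix (Fin (n + 1)) (Fin (n + 1)) ℝ := Matrix.of fun i j => q i j with hQ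
  have hsymm : Qᵀ = Q := by
    ext i j
    simp only [hQ, hq, Matrix.transpose_apply, Matrix.of_apply]
    rw [sumChooseMulChoose_comm, add_comm (j : ℕ)]
  have hshift : shiftMat (n + 1) * Q = Matrix.of fun i j : Fin (n + 1) => q (i + 1) j :=
    shiftMat_mul_of _ q fun j => by simp [hq, sumChooseMulChoose_self_left]
  have hshift' : Q * (shiftMat (n + 1))ᵀ = Matrix.of fun i j : Fin (n + 1) => q (j + 1) i := by
    have h := congrArg Matrix.transpose hshift
    rwa [Matrix.transpose_mul, hsymm] at h
  have hrow : firstVec (n + 1) ᵥ* Q = (1 / 2 : ℝ) • lBW n α := by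
    rw [firstVec_vecMul]
    ext j
    simp only [hQ, hq, lBW, Matrix.of_apply, Pi.smul_apply, smul_eq_mul, Fin.val_zero,
      sumChooseMulChoose_zero_left, zero_add]
    ring
  have hcol : Q *ᵥ firstVec (n + 1) = (1 / 2 : ℝ) • lBW n α := by
    rw [← hrow, ← Matrix.vecMul_transpose, hsymm]
  refine ⟨Q, hsymm, ?_, hrow⟩
  rw [Matrix.mul_vecMulVec, Matrix.vecMulVec_mul, hrow, hcol, Matrix.transpose_add,
    Matrix.transpose_transpose, Matrix.transpose_smul, Matrix.transpose_one, add_mul, mul_add,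
    hshift, hshift', smul_mul_assoc, mul_smul_comm, one_mul, mul_one]
  ext i j
  have hrec : (sumChooseMulChoose (n + 1) (i + 1) j : ℝ) + sumChooseMulChoose (n + 1) i (j + 1)
      + sumChooseMulChoose (n + 1) i j
        = (n + 1).choose (i + 1) * (n + 1).choose (j + 1) := by
    exact_mod_cast sumChooseMulChoose_recurrence (n + 1) i j
  simp only [hQ, hq, lBW, Matrix.sub_apply, Matrix.add_apply, Matrix.smul_apply, Matrix.of_apply,
    Matrix.vecMulVec_apply, Pi.smul_apply, smul_eq_mul, Matrix.zero_apply,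
    sumChooseMulChoose_comm (n + 1) (j + 1) i]
  linear_combination (1 / 2 * α ^ ((i : ℕ) + j + 2)) * hrec
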